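/- For every α > 0, β ∈ ℝ, and integers n, m ≥ 0, the derivatives of the generalized Hermite functions satisfy: ∫_ℝ ∂_x H_n^{α,β}(x) ∂_x H_m^{α,β}(x) dx equals √π α (n + 1/2) if m = n; equals −(α/2)√(π(l+1)(l+2)) with l = min{n,m} if |n − m| = 2; and equals 0 otherwise. -/

import Mathlib

open MeasureTheory Real Filter

/-- Physical Hermite polynomials: `𝓗 n x = (-1)^n e^{x²} (d/dx)^n e^{-x²}`. -/
noncomputable def physHermite (n : ℕ) : ℝ → ℝ :=
  fun x => (-1 : ℝ)^n * Real.exp (x^2) * iteratedDeriv n (fun y => Real.exp (-y^2)) x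

/-- Generalized Hermite functions with scaling factor `α` and translating factor `β`. -/
noncomputable def genHermite (α β : ℝ) (n : ℕ) : ℝ → ℝ :=
  fun x => (1 / Real.sqrt (2^n * n.factorial)) * physHermite n (α*(x-β)) *
    Real.exp (-α^2*(x-β)^2/2)

/-- The physical Hermite polynomials, defined by `P₀ = 1` and `Pₙ₊₁ = 2 X Pₙ - Pₙ'`. -/
noncomputable def hermitePoly : ℕ → Polynomial ℝ
  | 0 => 1
  | n + 1 => 2 * Polynomial.X * hermitePoly n - Polynomial.derivative (hermitePoly n)

lemma hasDerivAt_polynomial_mul_exp_neg_sq (p : Polynomial ℝ) (x : ℝ) :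
    HasDerivAt (fun y => p.eval y * exp (-y^2))
      ((Polynomial.derivative p - 2 * Polynomial.X * p).eval x * exp (-x^2)) x := by
  have h : HasDerivAt (fun y : ℝ => exp (-y^2)) (exp (-x^2) * (-(2 * x))) x := by
    simpa using ((hasDerivAt_pow 2 x).neg).exp
  refine ((p.hasDerivAt x).fun_mul h).congr_deriv ?_
  simp only [Polynomial.eval_sub, Polynomial.eval_mul, Polynomial.eval_X, Polynomial.eval_ofNat]
  ring

lemma iteratedDeriv_exp_neg_sq (n : ℕ) :
    iteratedDeriv n (fun y : ℝ => exp (-y^2)) =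
      fun x => (-1)^n * ((hermitePoly n).eval x * exp (-x^2)) := by
  induction n with
  | zero => simp [hermitePoly]
  | succ n ih =>
    rw [iteratedDeriv_succ, ih]
    funext x
    rw [((hasDerivAt_polynomial_mul_exp_neg_sq (hermitePoly n) x).const_mul _).deriv]
    simp only [hermitePoly, Polynomial.eval_sub]
    ring

lemma physHermite_eq_eval (n : ℕ) (x : ℝ) : physHermite n x = (hermitePoly n).eval x := by
  have h1 : exp (x^2) * exp (-x^2) = 1 := by rw [← exp_add]; simp
  have h2 : (-1 : ℝ)^n * (-1)^n = 1 := by rw [← mul_pow]; simp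
  simp only [physHermite, iteratedDeriv_exp_neg_sq]
  linear_combination (hermitePoly n).eval x * ((-1 : ℝ)^n * (-1)^n * h1 + h2)

lemma derivative_hermitePoly_succ (n : ℕ) :
    Polynomial.derivative (hermitePoly (n + 1)) = (2 * ((n : ℝ) + 1)) • hermitePoly n := by
  have hC : Polynomial.C (2 : ℝ) = 2 := map_ofNat _ 2
  induction n with
  | zero =>
    simp only [hermitePoly, Polynomial.smul_eq_C_mul]
    simp [hC]
  | succ n ih =>
    have h : hermitePoly (n + 1 + 1) = 2 * Polynomial.X * hermitePoly (n + 1)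
      - Polynomial.derivative (hermitePoly (n + 1)) := rfl
    rw [h, map_sub, ih, Polynomial.derivative_mul, ih, Polynomial.derivative_smul]
    simp only [Polynomial.smul_eq_C_mul, hermitePoly]
    simp [hC]
    ring

lemma integrable_polynomial_mul_exp_neg_sq (p : Polynomial ℝ) :
    Integrable (fun x : ℝ => p.eval x * exp (-x^2)) := by
  induction p using Polynomial.induction_on' with
  | add p q hp hq =>
    simp only [Polynomial.eval_add, add_mul]
    exact hp.add hq
  | monomial n a =>
    have hn : (-1 : ℝ) < n := by have := n.cast_nonneg (α := ℝ); linarith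
    have h := (integrable_rpow_mul_exp_neg_mul_sq one_pos hn).const_mul a
    simpa [Polynomial.eval_monomial, mul_assoc] using h

/-- Integration of a polynomial against the weight `e^{-x²}`. -/
noncomputable def gaussIntegral : Polynomial ℝ →ₗ[ℝ] ℝ where
  toFun p := ∫ x : ℝ, p.eval x * exp (-x^2)
  map_add' p q := by
    simp only [Polynomial.eval_add, add_mul]
    exact integral_add (integrable_polynomial_mul_exp_neg_sq p)
      (integrable_polynomial_mul_exp_neg_sq q)
  map_smul' c p := by
    simp only [Polynomial.eval_smul, smul_eq_mul, mul_assoc, RingHom.id_apply]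
    exact integral_const_mul _ _

lemma gaussIntegral_apply (p : Polynomial ℝ) :
    gaussIntegral p = ∫ x : ℝ, p.eval x * exp (-x^2) := rfl

lemma gaussIntegral_one : gaussIntegral 1 = √π := by
  simpa [gaussIntegral_apply] using integral_gaussian 1

lemma gaussIntegral_hermitePoly_succ_mul (n : ℕ) (q : Polynomial ℝ) :
    gaussIntegral (hermitePoly (n + 1) * q) =
      gaussIntegral (hermitePoly n * Polynomial.derivative q) := by
  have h := integral_eq_zero_of_hasDerivAt_of_integrable
    (hasDerivAt_polynomial_mul_exp_neg_sq (hermitePoly n * q))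
    (integrable_polynomial_mul_exp_neg_sq _) (integrable_polynomial_mul_exp_neg_sq _)
  rw [← gaussIntegral_apply] at h
  rw [← sub_eq_zero, ← map_sub, ← neg_eq_zero, ← map_neg, ← h]
  congr 1
  simp only [hermitePoly, Polynomial.derivative_mul]
  ring

lemma gaussIntegral_hermitePoly_mul_hermitePoly (n m : ℕ) :
    gaussIntegral (hermitePoly n * hermitePoly m) =
      if n = m then 2^n * n.factorial * √π else 0 := by
  induction n generalizing m with
  | zero =>
    cases m with
    | zero => simp [hermitePoly, gaussIntegral_one]
    | succ m =>
      rw [mul_comm, gaussIntegral_hermitePoly_succ_mul]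
      simp [hermitePoly]
  | succ n ih =>
    rw [gaussIntegral_hermitePoly_succ_mul]
    cases m with
    | zero => simp [hermitePoly]
    | succ m =>
      rw [derivative_hermitePoly_succ, mul_smul_comm, map_smul, ih]
      by_cases h : n = m
      · subst h
        simp [Nat.factorial_succ]
        ring
      · simp [h]

lemma deriv_genHermite (α β : ℝ) (n : ℕ) (x : ℝ) :
    deriv (genHermite α β n) x = α / (2 * √(2^n * n.factorial)) *
      (Polynomial.derivative (hermitePoly n) - hermitePoly (n + 1)).eval (α * (x - β)) *
      exp (-α^2 * (x - β)^2 / 2) := by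
  have hf : genHermite α β n = fun x => (1 / √(2^n * n.factorial)) *
      ((hermitePoly n).eval (α * (x - β)) * exp (-α^2 * (x - β)^2 / 2)) := by
    funext x
    simp only [genHermite, physHermite_eq_eval, mul_assoc]
  have hl : HasDerivAt (fun x => α * (x - β)) α x := by
    simpa using ((hasDerivAt_id x).sub_const β).const_mul α
  have he : HasDerivAt (fun x => exp (-α^2 * (x - β)^2 / 2))
      (exp (-α^2 * (x - β)^2 / 2) * (-α^2 * (x - β))) x := by
    have h := (((hasDerivAt_id' x).sub_const β).fun_pow 2).const_mul (-α^2)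
    refine (h.div_const 2).exp.congr_deriv ?_
    simp
    ring
  have hp : HasDerivAt (fun x => (hermitePoly n).eval (α * (x - β)))
      ((Polynomial.derivative (hermitePoly n)).eval (α * (x - β)) * α) x :=
    HasDerivAt.comp (h₂ := fun y => (hermitePoly n).eval y) x
      ((hermitePoly n).hasDerivAt (α * (x - β))) hl
  rw [hf, ((hp.fun_mul he).const_mul _).deriv]
  simp only [hermitePoly, Polynomial.eval_sub, Polynomial.eval_mul, Polynomial.eval_X,
    Polynomial.eval_ofNat]
  ring

lemma integral_deriv_genHermite_mul (α β : ℝ) (hα : 0 < α) (n m : ℕ) :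
    ∫ x : ℝ, deriv (genHermite α β n) x * deriv (genHermite α β m) x =
      α / (4 * (√(2^n * n.factorial) * √(2^m * m.factorial))) *
        gaussIntegral ((Polynomial.derivative (hermitePoly n) - hermitePoly (n + 1)) *
          (Polynomial.derivative (hermitePoly m) - hermitePoly (m + 1))) := by
  set p := Polynomial.derivative (hermitePoly n) - hermitePoly (n + 1) with hp
  set q := Polynomial.derivative (hermitePoly m) - hermitePoly (m + 1) with hq
  set K := α^2 / (4 * (√(2^n * n.factorial) * √(2^m * m.factorial))) with hK
  have h1 : ∀ x, deriv (genHermite α β n) x * deriv (genHermite α β m) x =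
      K * (fun z => (fun y => (p * q).eval y * exp (-y^2)) (α * z)) (x - β) := by
    intro x
    have he : exp (-(α * (x - β))^2) =
        exp (-α^2 * (x - β)^2 / 2) * exp (-α^2 * (x - β)^2 / 2) := by
      rw [← exp_add]
      ring_nf
    simp only [deriv_genHermite, ← hp, ← hq, hK, he, Polynomial.eval_mul]
    ring
  simp_rw [h1]
  rw [integral_const_mul,
    integral_sub_right_eq_self (fun z => (fun y => (p * q).eval y * exp (-y^2)) (α * z)) β,
    Measure.integral_comp_mul_left (fun y => (p * q).eval y * exp (-y^2)), ← gaussIntegral_apply, abs_of_pos (inv_pos.2 hα), smul_eq_mul,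
    hK]
  field_simp

lemma sqrt_mul_sqrt_add_two (n : ℕ) :
    √(2^n * n.factorial) * √(2^(n + 2) * (n + 2).factorial) =
      2^(n + 1) * n.factorial * √(((n : ℝ) + 1) * (n + 2)) := by
  have h : (2^n * n.factorial : ℝ) * (2^(n + 2) * (n + 2).factorial) =
      (2^(n + 1) * n.factorial)^2 * (((n : ℝ) + 1) * (n + 2)) := by
    simp only [Nat.factorial_succ]
    push_cast
    ring
  rw [← sqrt_mul (by positivity), h, sqrt_mul (by positivity), sqrt_sq (by positivity)]

/-- "Orthogonality" of the derivatives of the generalized Hermite functions: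
`∫ ∂_x H_n^{α,β} ∂_x H_m^{α,β}` equals `√π α (n + 1/2)` if `m = n`, equals
`−(α/2)√(π(l+1)(l+2))` with `l = min{n,m}` if `|n − m| = 2`, and `0` otherwise. -/
theorem stmt4 (α β : ℝ) (hα : 0 < α) (n m : ℕ) :
    ∫ x : ℝ, deriv (genHermite α β n) x * deriv (genHermite α β m) x =
      if n = m then Real.sqrt Real.pi * α * ((n : ℝ) + 1/2)
      else if n + 2 = m ∨ m + 2 = n then
        -(α/2) * Real.sqrt (Real.pi * ((min n m : ℝ) + 1) * ((min n m : ℝ) + 2))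
      else 0 := by
  wlog hnm : n ≤ m generalizing n m
  · have h := this m n (by omega)
    simp_rw [mul_comm (deriv (genHermite α β n) _)]
    have hne : n ≠ m := by omega
    have hor : (m + 2 = n ∨ n + 2 = m) ↔ (n + 2 = m ∨ m + 2 = n) := or_comm
    rw [h, if_neg hne.symm, if_neg hne, min_comm]
    simp only [hor]
  rw [integral_deriv_genHermite_mul α β hα]
  rcases eq_or_ne n m with rfl | hne
  · rw [if_pos rfl, mul_self_sqrt (by positivity)]
    cases n with
    | zero =>
      have h := gaussIntegral_hermitePoly_mul_hermitePoly 1 1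
      simp only [show Polynomial.derivative (hermitePoly 0) = 0 by simp [hermitePoly], zero_sub,
        neg_mul_neg, zero_add, h]
      simp
      ring
    | succ k =>
      simp only [derivative_hermitePoly_succ, sub_mul, mul_sub, smul_mul_assoc, mul_smul_comm,
        map_sub, map_smul, gaussIntegral_hermitePoly_mul_hermitePoly, smul_eq_mul]
      rw [if_neg (show k ≠ k + 1 + 1 by omega), if_neg (show k + 1 + 1 ≠ k by omega)]
      simp [Nat.factorial_succ]
      field_simp
      ring
  rw [if_neg hne]
  obtain ⟨k, rfl⟩ : ∃ k, m = k + 1 := ⟨m - 1, by omega⟩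
  have hk : gaussIntegral ((Polynomial.derivative (hermitePoly n) - hermitePoly (n + 1)) *
      (Polynomial.derivative (hermitePoly (k + 1)) - hermitePoly (k + 1 + 1))) =
      -(2 * ((k : ℝ) + 1)) * gaussIntegral (hermitePoly (n + 1) * hermitePoly k) := by
    cases n with
    | zero =>
      simp only [derivative_hermitePoly_succ,
        show Polynomial.derivative (hermitePoly 0) = 0 by simp [hermitePoly],
        sub_mul, mul_sub, mul_smul_comm, zero_mul, map_zero,
        map_sub, map_smul, gaussIntegral_hermitePoly_mul_hermitePoly, smul_eq_mul]
      simp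
      split_ifs <;> simp
    | succ j =>
      simp only [derivative_hermitePoly_succ, sub_mul, mul_sub, smul_mul_assoc, mul_smul_comm,
        map_sub, map_smul, gaussIntegral_hermitePoly_mul_hermitePoly, smul_eq_mul]
      rw [if_neg (show j ≠ k by omega), if_neg (show j ≠ k + 1 + 1 by omega),
        if_neg (show j + 1 + 1 ≠ k + 1 + 1 by omega)]
      ring
  rw [hk, gaussIntegral_hermitePoly_mul_hermitePoly]
  by_cases h2 : n + 1 = k
  · subst h2
    rw [if_pos rfl, if_pos (Or.inl rfl), min_eq_left (by push_cast; linarith), sqrt_mul_sqrt_add_two,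
      mul_assoc π, sqrt_mul pi_pos.le]
    have hs : √(((n : ℝ) + 1) * (n + 2)) ^ 2 = (n + 1) * (n + 2) := sq_sqrt (by positivity)
    have hs0 : √(((n : ℝ) + 1) * (n + 2)) ≠ 0 := (sqrt_pos.2 (by positivity)).ne'
    simp only [Nat.factorial_succ]
    push_cast
    field_simp
    rw [hs]
    ring
  · rw [if_neg h2, if_neg (by omega), mul_zero, mul_zero]
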